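/- arXiv:1902.00767 — 3 statements merged into one kernel-verified Lean document; each statement's English description precedes it below -/
import Mathlib

section
/- Let k = 𝔽_q and let P ∈ k[x,y,z] be a polynomial of total degree exactly a with a < q. Let ℒ be the set of affine lines in k³ and ℒ_P ⊆ ℒ the subset of lines L such that the restriction of P to L (as a polynomial in the line parameter) has degree < a. Then |ℒ_P| / |ℒ| ≤ a/q. -/
open MvPolynomial

theorem mon_aux {k : Type*} [Field k] (v w : Fin 3 → k) (s : Fin 3 → ℕ) :
    (∏ i, (Polynomial.C (v i) + Polynomial.C (w i) * Polynomial.X) ^ (s i)).natDegree ≤ ∑ i, s i ∧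
    (∏ i, (Polynomial.C (v i) + Polynomial.C (w i) * Polynomial.X) ^ (s i)).coeff (∑ i, s i)
      = ∏ i, w i ^ s i := by
  have h0 : ∀ i, (Polynomial.C (v i) + Polynomial.C (w i) * Polynomial.X).natDegree ≤ 1 := by
    intro i
    compute_degree
  have h1 : ∀ i, ((Polynomial.C (v i) + Polynomial.C (w i) * Polynomial.X) ^ (s i)).natDegree
      ≤ s i := by
    intro i
    simpa using Polynomial.natDegree_pow_le_of_le (s i) (h0 i)
  have h2 : ∀ i, ((Polynomial.C (v i) + Polynomial.C (w i) * Polynomial.X) ^ (s i)).coeff (s i)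
      = w i ^ s i := by
    intro i
    have := Polynomial.coeff_pow_of_natDegree_le (m := s i) (h0 i)
    rw [mul_one] at this
    rw [this]
    simp
  simp only [Fin.prod_univ_three, Fin.sum_univ_three]
  have h3 := Polynomial.natDegree_mul_le_of_le (h1 0) (h1 1)
  refine ⟨Polynomial.natDegree_mul_le_of_le h3 (h1 2), ?_⟩
  rw [Polynomial.coeff_mul_add_eq_of_natDegree_le h3 (h1 2),
    Polynomial.coeff_mul_add_eq_of_natDegree_le (h1 0) (h1 1), h2, h2, h2]

theorem line_aux {k : Type*} [Field k] [Fintype k] (a : ℕ)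
    (ha : a < Fintype.card k)
    (P : MvPolynomial (Fin 3) k) (hdeg : P.totalDegree = a) (v w : Fin 3 → k)
    (p : Polynomial k) (hp : p.natDegree < a)
    (h : ∀ t : k, Polynomial.eval t p = MvPolynomial.eval (v + t • w) P) :
    MvPolynomial.eval w (homogeneousComponent a P) = 0 := by
  classical
  set Q : Polynomial k := ∑ s ∈ P.support, Polynomial.C (coeff s P) *
    ∏ i, (Polynomial.C (v i) + Polynomial.C (w i) * Polynomial.X) ^ (s i) with hQ
  have hs : ∀ s ∈ P.support, ∑ i, s i ≤ a := by
    intro s hs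
    have := le_totalDegree hs
    rw [hdeg, Finsupp.sum_fintype _ _ (by simp)] at this
    exact this
  have hQd : Q.natDegree ≤ a := by
    refine Polynomial.natDegree_sum_le_of_forall_le _ _ fun s hs' => ?_
    exact (Polynomial.natDegree_C_mul_le _ _).trans ((mon_aux v w s).1.trans (hs s hs'))
  have hpQ : p = Q := by
    refine Polynomial.eq_of_natDegree_lt_card_of_eval_eq p Q (f := id) Function.injective_id ?_
      (max_lt (hp.trans ha) (hQd.trans_lt ha))
    intro t
    rw [id, h, hQ, MvPolynomial.eval_eq', Polynomial.eval_finsetSum]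
    refine Finset.sum_congr rfl fun s _ => ?_
    rw [Polynomial.eval_C_mul, Polynomial.eval_prod]
    refine congrArg _ (Finset.prod_congr rfl fun i _ => ?_)
    simp only [Polynomial.eval_pow, Polynomial.eval_add, Polynomial.eval_mul, Polynomial.eval_C,
      Polynomial.eval_X, Pi.add_apply, Pi.smul_apply, smul_eq_mul]
    rw [mul_comm t]
  have hc : Q.coeff a = 0 := by
    rw [← hpQ]
    exact Polynomial.coeff_eq_zero_of_natDegree_lt hp
  rw [← hc, hQ, Polynomial.finsetSum_coeff, homogeneousComponent_apply, map_sum,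
    Finset.sum_filter]
  refine Finset.sum_congr rfl fun s hs' => ?_
  rw [Polynomial.coeff_C_mul, Finsupp.degree_eq_sum]
  split_ifs with he
  · rw [← he, (mon_aux v w s).2, eval_monomial, Finsupp.prod_fintype _ _ (by simp)]
  · rw [Polynomial.coeff_eq_zero_of_natDegree_lt, mul_zero]
    exact (mon_aux v w s).1.trans_lt (lt_of_le_of_ne (hs s hs') he)

theorem top_ne {k : Type*} [Field k] (a : ℕ) (ha : 0 < a)
    (P : MvPolynomial (Fin 3) k) (hdeg : P.totalDegree = a) :
    homogeneousComponent a P ≠ 0 := by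
  have hP : P ≠ 0 := by
    rintro rfl
    simp at hdeg
    omega
  obtain ⟨s, hs, hs'⟩ := Finset.exists_mem_eq_sup P.support
    (by simpa using hP) (fun s => s.sum fun _ e => e)
  have h1 : s.degree = a := by
    rw [← hdeg, totalDegree, hs']
    rfl
  intro h0
  have := congrArg (coeff s) h0
  rw [coeff_homogeneousComponent, if_pos h1] at this
  exact (mem_support_iff.mp hs) (by simpa using this)

theorem count_aux {k : Type*} [Field k] [Fintype k] [DecidableEq k] (a : ℕ) (ha : 0 < a)
    (P : MvPolynomial (Fin 3) k) (hdeg : P.totalDegree = a) :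
    (Finset.univ.filter fun w : Fin 3 → k => w ≠ 0 ∧
      eval w (homogeneousComponent a P) = 0).card + 1 ≤ a * Fintype.card k ^ 2 := by
  have hH := top_ne a ha P hdeg
  have hz : eval (0 : Fin 3 → k) (homogeneousComponent a P) = 0 := by
    rw [eval_zero, constantCoeff_eq, coeff_homogeneousComponent, if_neg]
    simp
    omega
  have hsz := schwartz_zippel_totalDegree hH (Finset.univ : Finset k)
  have htd : (homogeneousComponent a P).totalDegree ≤ a :=
    (homogeneousComponent_isHomogeneous a P).totalDegree_le
  have hq : 0 < Fintype.card k := Fintype.card_pos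
  have hq' : (0 : ℚ≥0) < Fintype.card k := by exact_mod_cast hq
  rw [div_le_div_iff₀ (by simpa using pow_pos hq' 3) (by simpa using hq')] at hsz
  simp only [Fintype.piFinset_univ, Finset.card_univ] at hsz
  set Z := Finset.univ.filter fun w : Fin 3 → k => eval w (homogeneousComponent a P) = 0 with hZ
  have h1 : Z.card * Fintype.card k ≤
    (homogeneousComponent a P).totalDegree * Fintype.card k ^ 3 := by exact_mod_cast hsz
  have h2 : Z.card ≤ a * Fintype.card k ^ 2 := by
    refine Nat.le_of_mul_le_mul_right (h1.trans ?_) hq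
    calc _ ≤ a * Fintype.card k ^ 3 := by gcongr
      _ = _ := by ring
  refine le_trans ?_ h2
  rw [← Finset.card_erase_add_one (s := Z) (a := 0) (Finset.mem_filter.mpr ⟨Finset.mem_univ _, hz⟩)]
  gcongr
  intro w
  simp [hZ]


/-- Let k = 𝔽_q and P a polynomial in three variables of total degree
exactly a, with a < q. Among all (parametrized) affine lines t ↦ v + t•w (w ≠ 0)
in k³, the proportion of those on which P restricts to a polynomial of degree < a
is at most a/q.  (Each line has the same number q(q-1) of parametrizations, so
counting parametrized lines is equivalent to counting lines.) -/
theorem stmt6 {k : Type*} [Field k] [Fintype k] (a : ℕ)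
    (ha : a < Fintype.card k)
    (P : MvPolynomial (Fin 3) k) (hdeg : P.totalDegree = a) :
    Fintype.card k *
      Nat.card {vw : (Fin 3 → k) × (Fin 3 → k) // vw.2 ≠ 0 ∧
        ∃ p : Polynomial k, p.natDegree < a ∧
          ∀ t : k, Polynomial.eval t p = MvPolynomial.eval (vw.1 + t • vw.2) P}
    ≤ a * Nat.card {vw : (Fin 3 → k) × (Fin 3 → k) // vw.2 ≠ 0} := by
  classical
  rcases Nat.eq_zero_or_pos a with rfl | hpos
  · simp
  set q := Fintype.card k with hq
  set Z := Finset.univ.filter fun w : Fin 3 → k => w ≠ 0 ∧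
      eval w (homogeneousComponent a P) = 0 with hZ
  have hN : Z.card + 1 ≤ a * q ^ 2 := count_aux a hpos P hdeg
  have h1 : Nat.card {vw : (Fin 3 → k) × (Fin 3 → k) // vw.2 ≠ 0 ∧
        ∃ p : Polynomial k, p.natDegree < a ∧
          ∀ t : k, Polynomial.eval t p = MvPolynomial.eval (vw.1 + t • vw.2) P}
      ≤ q ^ 3 * Z.card := by
    rw [Nat.card_eq_fintype_card, Fintype.card_subtype]
    have : q ^ 3 * Z.card = ((Finset.univ : Finset (Fin 3 → k)) ×ˢ Z).card := by
      simp [hq]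
    rw [this]
    apply Finset.card_le_card
    rintro ⟨v, w⟩ h
    simp only [Finset.mem_filter, Finset.mem_univ, true_and] at h
    obtain ⟨hw, p, hp, hp'⟩ := h
    simp only [Finset.mem_product, Finset.mem_univ, true_and, hZ, Finset.mem_filter]
    exact ⟨hw, line_aux a ha P hdeg v w p hp hp'⟩
  have h2 : Nat.card {vw : (Fin 3 → k) × (Fin 3 → k) // vw.2 ≠ 0} = q ^ 3 * (q ^ 3 - 1) := by
    rw [Nat.card_eq_fintype_card, Fintype.card_subtype]
    have : q ^ 3 * (q ^ 3 - 1) = ((Finset.univ : Finset (Fin 3 → k)) ×ˢ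
        (Finset.univ.erase (0 : Fin 3 → k))).card := by
      simp [hq, Finset.card_erase_of_mem]
    rw [this]
    congr 1
    ext ⟨v, w⟩
    simp
  rw [h2]
  have hq3 : 1 ≤ q ^ 3 := Nat.one_le_pow _ _ (by omega)
  have key : q * Z.card ≤ a * (q ^ 3 - 1) := by
    obtain ⟨m, hm⟩ := Nat.exists_eq_add_of_le hq3
    have h3 : q * (Z.card + 1) ≤ q * (a * q ^ 2) := Nat.mul_le_mul_left _ hN
    have h4 : q * (a * q ^ 2) = a * q ^ 3 := by ring
    rw [h4, hm] at h3
    rw [hm, Nat.add_sub_cancel_left]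
    nlinarith
  calc _ ≤ q * (q ^ 3 * Z.card) := Nat.mul_le_mul_left _ h1
    _ = q ^ 3 * (q * Z.card) := by ring
    _ ≤ q ^ 3 * (a * (q ^ 3 - 1)) := Nat.mul_le_mul_left _ key
    _ = _ := by ring
end

section
/- Let k = 𝔽_q and let P₁,…,P_c ∈ k[x₁,…,x_n] be polynomials of degrees d₁,…,d_c such that the affine variety Y = {x : P₁(x)=⋯=P_c(x)=0} over the algebraic closure has dimension n − c. Then |Y(𝔽_q)| ≤ q^{n-c} · ∏_{i=1}^c d_i. -/
open MvPolynomial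

namespace Bez

/-- there is a strict chain of primes of length `r` from `p` to `m` -/
def HasChain {A : Type*} [CommRing A] (p m : PrimeSpectrum A) (r : ℕ) : Prop :=
  ∃ l : LTSeries (PrimeSpectrum A), l.head = p ∧ l.last = m ∧ l.length = r

lemma HasChain.le {A : Type*} [CommRing A] {p m : PrimeSpectrum A} {r : ℕ}
    (h : HasChain p m r) : p ≤ m := by
  obtain ⟨l, rfl, rfl, -⟩ := h
  exact LTSeries.head_le_last l

lemma HasChain.eq {A : Type*} [CommRing A] {p m : PrimeSpectrum A}
    (h : HasChain p m 0) : p = m := by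
  obtain ⟨l, rfl, rfl, h⟩ := h
  rw [RelSeries.head, RelSeries.last]
  congr 1
  ext
  simp [h]

lemma HasChain.ne {A : Type*} [CommRing A] {p m : PrimeSpectrum A} {r : ℕ}
    (h : HasChain p m (r + 1)) : p ≠ m := by
  obtain ⟨l, rfl, rfl, h⟩ := h
  have : l.head < l.last := l.strictMono (by rw [Fin.lt_def]; simp [h])
  exact this.ne

lemma HasChain.cut {A : Type*} [CommRing A] [IsNoetherianRing A] {p m : PrimeSpectrum A} {r : ℕ}
    (h : HasChain p m (r + 1)) {f : A} (hf : f ∈ m.asIdeal) :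
    ∃ p', p ≤ p' ∧ f ∈ p'.asIdeal ∧ HasChain p' m r := by
  obtain ⟨l, rfl, rfl, h⟩ := h
  obtain ⟨q, hq, hl, h1, h2⟩ := PrimeSpectrum.exist_ltSeries_mem_one_of_mem_last l hf
  refine ⟨q 1, ?_, hq, q.tail (by omega), by simp, by simp [h2], ?_⟩
  · rw [h1]; exact LTSeries.head_le q 1
  · simp; omega

lemma HasChain.cutList {A : Type*} [CommRing A] [IsNoetherianRing A] {m : PrimeSpectrum A}
    {r : ℕ} (L : List A) : ∀ {p : PrimeSpectrum A}, HasChain p m (r + L.length) →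
    (∀ f ∈ L, f ∈ m.asIdeal) →
    ∃ p', p ≤ p' ∧ (∀ f ∈ L, f ∈ p'.asIdeal) ∧ HasChain p' m r := by
  induction L with
  | nil => intro p h _; exact ⟨p, le_rfl, by simp, h⟩
  | cons f L ih =>
    intro p h hm
    obtain ⟨p1, h1, h2, h3⟩ := HasChain.cut (r := r + L.length) h (hm f (by simp))
    obtain ⟨p2, h4, h5, h6⟩ := ih h3 (fun g hg => hm g (by simp [hg]))
    refine ⟨p2, h1.trans h4, ?_, h6⟩
    intro g hg
    rcases List.mem_cons.1 hg with rfl | hg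
    · exact h4 h2
    · exact h5 g hg

lemma HasChain.le_dim {A : Type*} [CommRing A] {p m : PrimeSpectrum A} {r : ℕ}
    (h : HasChain p m r) {I : Ideal A} (hI : I ≤ p.asIdeal) : (r : WithBot ℕ∞) ≤ ringKrullDim (A ⧸ I) := by
  obtain ⟨l, rfl, rfl, rfl⟩ := h
  rw [ringKrullDim_quotient]
  let l' : LTSeries (PrimeSpectrum.zeroLocus (R := A) I) :=
    { length := l.length
      toFun := fun i => ⟨l i, fun x hx => (LTSeries.head_le l i) (hI hx)⟩
      step := fun i => l.step i }
  exact Order.LTSeries.length_le_krullDim l'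

/-! numeric part -/

lemma pow_step (t d r : ℕ) : (t + d) ^ (r + 1) ≤ t ^ (r + 1) + d * (r + 1) * (t + d) ^ r := by
  induction r with
  | zero => simp
  | succ r ih =>
    have h1 : t ^ (r+1) ≤ (t+d)^(r+1) := Nat.pow_le_pow_left (by omega) _
    calc (t + d) ^ (r + 1 + 1) = (t+d)^(r+1) * t + d * (t+d)^(r+1) := by ring
      _ ≤ (t ^ (r + 1) + d * (r + 1) * (t + d) ^ r) * t + d * (t+d)^(r+1) := by gcongr
      _ = t^(r+2) + d * (r+1) * ((t+d)^r * t) + d * (t+d)^(r+1) := by ring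
      _ ≤ t^(r+2) + d * (r+1) * ((t+d)^r * (t + d)) + d * (t+d)^(r+1) := by gcongr; omega
      _ = _ := by ring

/-- Lower-bound growth propagation. -/
lemma growth (G H : ℕ → ℕ) (N D d r : ℕ) (h : ∀ m, H (m + d) + G m ≤ G (m + d))
    (hH : ∃ m0, ∀ t, N * t ^ r ≤ H (m0 + t) * (D * r.factorial)) :
    ∃ m0, ∀ t, N * t ^ (r + 1) ≤ G (m0 + t) * ((d * D) * (r + 1).factorial) := by
  obtain ⟨m0, hm⟩ := hH
  rcases Nat.eq_zero_or_pos d with rfl | hd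
  · have h1 := h (m0 + 1)
    have h2 := hm 1
    have : H (m0 + 1) = 0 := by simpa using h1
    simp [this] at h2
    subst h2
    exact ⟨0, by simp⟩
  refine ⟨m0 + d, fun t => ?_⟩
  induction t using Nat.strong_induction_on with
  | _ t ih =>
    have e : m0 + d + t = (m0 + t) + d := by ring
    have h1 := h (m0 + t)
    have h2 := hm (t + d)
    rw [e]
    rw [← add_assoc] at h2
    have h3 : N * t ^ r ≤ H (m0 + t + d) * (D * r.factorial) :=
      le_trans (by gcongr; omega) h2
    have h4 : d * (r + 1) * (N * t ^ r) ≤ H (m0 + t + d) * ((d * D) * (r+1).factorial) := by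
      calc _ ≤ d * (r+1) * (H (m0 + t + d) * (D * r.factorial)) := by gcongr
        _ = _ := by rw [Nat.factorial_succ]; ring
    by_cases htd : t < d
    · calc N * t ^ (r+1) = t * 1 * (N * t^r) := by ring
        _ ≤ d * (r+1) * (N * t^r) := by gcongr; omega
        _ ≤ _ := h4
        _ ≤ _ := by gcongr; omega
    · obtain ⟨s, rfl⟩ : ∃ s, t = s + d := ⟨t - d, by omega⟩
      have h5 := ih s (by omega)
      have e2 : m0 + d + s = m0 + (s + d) := by ring
      rw [e2] at h5
      calc N * (s + d) ^ (r+1) ≤ N * (s ^ (r+1) + d * (r+1) * (s+d)^r) := by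
            gcongr; exact pow_step s d r
        _ = N * s^(r+1) + d * (r+1) * (N * (s+d)^r) := by ring
        _ ≤ G (m0 + (s + d)) * ((d * D) * (r + 1).factorial)
            + H (m0 + (s+d) + d) * ((d * D) * (r+1).factorial) := by gcongr
        _ = (H (m0 + (s+d) + d) + G (m0 + (s + d))) * ((d * D) * (r + 1).factorial) := by ring
        _ ≤ _ := by gcongr

lemma final_le (N D a n : ℕ) (h : ∀ t : ℕ, N * t ^ n ≤ D * (t + a) ^ n) : N ≤ D := by
  have h1 : Filter.Tendsto (fun t : ℕ => (D : ℝ) * (1 + (a : ℝ) / t) ^ n) Filter.atTop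
      (nhds ((D : ℝ) * (1 + 0) ^ n)) := by
    refine Filter.Tendsto.const_mul _ (Filter.Tendsto.pow (Filter.Tendsto.const_add _ ?_) _)
    exact tendsto_const_div_atTop_nhds_zero_nat (a : ℝ)
  have h2 : (N : ℝ) ≤ (D : ℝ) * (1 + 0) ^ n := by
    refine ge_of_tendsto h1 ?_
    filter_upwards [Filter.eventually_gt_atTop 0] with t ht
    have ht' : (0 : ℝ) < t := by exact_mod_cast ht
    have h3 : (N : ℝ) * t ^ n ≤ D * (t + a) ^ n := by exact_mod_cast h t
    have h4 : (1 + (a : ℝ) / t) ^ n = (t + a) ^ n / t ^ n := by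
      rw [← div_pow]; congr 1; field_simp
    rw [h4, ← mul_div_assoc, le_div_iff₀ (by positivity)]
    exact h3
  simpa using h2

/-! Hilbert function -/
section
variable {K : Type*} [Field K] {n : ℕ}

/-- image of polynomials of degree at most `m` in the quotient -/
noncomputable def W (I : Ideal (MvPolynomial (Fin n) K)) (m : ℕ) :
    Submodule K (MvPolynomial (Fin n) K ⧸ I) :=
  (restrictTotalDegree (Fin n) K m).map (Ideal.Quotient.mkₐ K I).toLinearMap

instance (I : Ideal (MvPolynomial (Fin n) K)) (m : ℕ) : Module.Finite K (W I m) := by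
  unfold W; infer_instance

noncomputable def H (I : Ideal (MvPolynomial (Fin n) K)) (m : ℕ) : ℕ := Module.finrank K (W I m)

lemma H_le (I : Ideal (MvPolynomial (Fin n) K)) (m : ℕ) :
    H I m * n.factorial ≤ (m + n) ^ n := by
  have h1 : H I m ≤ Module.finrank K (restrictTotalDegree (Fin n) K m) :=
    Submodule.finrank_map_le _ _
  have h2 : Module.finrank K (restrictTotalDegree (Fin n) K m)
      = Nat.card {s : Fin n →₀ ℕ | (s.sum fun _ e => e) ≤ m} :=
    Module.finrank_eq_nat_card_basis (basisRestrictSupport K _)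
  have h3 : Nat.card {s : Fin n →₀ ℕ | (s.sum fun _ e => e) ≤ m}
      ≤ Nat.card ((Finset.univ : Finset (Fin (n+1))).finsuppAntidiag m) := by
    refine Nat.card_le_card_of_injective
      (fun s => ⟨Finsupp.cons (m - (s.1.sum fun _ e => e)) s.1, ?_⟩) ?_
    · rw [Finset.mem_finsuppAntidiag]
      refine ⟨?_, Finset.subset_univ _⟩
      have hs := s.2
      simp only [Set.mem_ofPred_eq] at hs
      rw [Fin.sum_univ_succ]
      simp only [Finsupp.cons_zero, Finsupp.cons_succ]
      rw [Finsupp.sum_fintype _ _ (by simp)] at hs ⊢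
      omega
    · intro s t hst
      have := congrArg (fun u => Finsupp.tail u.1) hst
      simp only [Finsupp.tail_cons] at this
      exact Subtype.ext this
  have h5 : Nat.card ((Finset.univ : Finset (Fin (n+1))).finsuppAntidiag m)
      = (n + 1 + m - 1).choose m := by
    rw [Nat.card_eq_fintype_card, Fintype.card_coe, Finset.card_finsuppAntidiag_nat_eq_choose]
    simp only [Finset.card_univ, Fintype.card_fin]
  have h4 : (n + 1 + m - 1).choose m = (m + n).choose n := by
    rw [show n + 1 + m - 1 = m + n by omega]
    exact Nat.choose_symm_add
  calc H I m * n.factorial ≤ (m+n).choose n * n.factorial := by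
        gcongr; omega
    _ = (m+n).descFactorial n := by rw [Nat.descFactorial_eq_factorial_mul_choose, mul_comm]
    _ ≤ _ := Nat.descFactorial_le_pow _ _

lemma mem_W {I : Ideal (MvPolynomial (Fin n) K)} {m : ℕ} {g : MvPolynomial (Fin n) K}
    (h : g.totalDegree ≤ m) : Ideal.Quotient.mk I g ∈ W I m :=
  ⟨g, (mem_restrictTotalDegree _ _ _).2 h, rfl⟩

lemma H_step (I I' : Ideal (MvPolynomial (Fin n) K)) (f : MvPolynomial (Fin n) K) (d : ℕ)
    (hII : I ≤ I') (hf : f ∈ I') (hd : f.totalDegree ≤ d)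
    (hnz : ∀ a, f * a ∈ I → a ∈ I) (m : ℕ) : H I' (m + d) + H I m ≤ H I (m + d) := by
  let φ : (MvPolynomial (Fin n) K ⧸ I) →ₗ[K] (MvPolynomial (Fin n) K ⧸ I') :=
    (Ideal.Quotient.factorₐ K hII).toLinearMap
  have hφ : ∀ g, φ (Ideal.Quotient.mk I g) = Ideal.Quotient.mk I' g := fun g => rfl
  let μ : (MvPolynomial (Fin n) K ⧸ I) →ₗ[K] (MvPolynomial (Fin n) K ⧸ I) :=
    LinearMap.mulLeft K (Ideal.Quotient.mk I f)
  have hμ : Function.Injective μ := by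
    rw [← LinearMap.ker_eq_bot, LinearMap.ker_eq_bot']
    intro a ha
    obtain ⟨a, rfl⟩ := Ideal.Quotient.mk_surjective a
    rw [LinearMap.mulLeft_apply, ← map_mul, Ideal.Quotient.eq_zero_iff_mem] at ha
    exact Ideal.Quotient.eq_zero_iff_mem.2 (hnz a ha)
  have hμW : ∀ w ∈ W I m, μ w ∈ W I (m + d) := by
    rintro _ ⟨g, hg, rfl⟩
    have hg' := (mem_restrictTotalDegree _ _ _).1 hg
    have : μ (Ideal.Quotient.mk I g) = Ideal.Quotient.mk I (f * g) := by simp [μ]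
    change μ (Ideal.Quotient.mk I g) ∈ _
    rw [this]
    refine mem_W ((totalDegree_mul _ _).trans (by omega))
  let ψ := φ.domRestrict (W I (m + d))
  have hr : LinearMap.range ψ = W I' (m + d) := by
    rw [LinearMap.range_domRestrict]
    ext y; constructor
    · rintro ⟨_, ⟨g, hg, rfl⟩, rfl⟩
      exact ⟨g, hg, rfl⟩
    · rintro ⟨g, hg, rfl⟩
      exact ⟨_, ⟨g, hg, rfl⟩, rfl⟩
  let ν : W I m →ₗ[K] LinearMap.ker ψ :=
    (μ.restrict hμW).codRestrict _ (by
      rintro ⟨_, ⟨g, hg, rfl⟩⟩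
      rw [LinearMap.mem_ker]
      change φ (μ (Ideal.Quotient.mk I g)) = 0
      have : μ (Ideal.Quotient.mk I g) = Ideal.Quotient.mk I (f * g) := by simp [μ]
      rw [this, hφ, Ideal.Quotient.eq_zero_iff_mem]
      exact Ideal.mul_mem_right _ _ hf)
  have hν : Function.Injective ν := by
    intro a b hab
    have h1 : μ a.1 = μ b.1 := congrArg (fun z => z.1.1) hab
    exact Subtype.ext (hμ h1)
  have h1 := LinearMap.finrank_range_add_finrank_ker ψ
  have h2 := LinearMap.finrank_le_finrank_of_injective hν
  rw [hr] at h1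
  unfold H
  omega


/-- the maximal ideal of a point -/
noncomputable def mx (x : Fin n → K) : PrimeSpectrum (MvPolynomial (Fin n) K) :=
  ⟨RingHom.ker (eval x), RingHom.ker_isPrime _⟩

lemma mem_mx (x : Fin n → K) (f : MvPolynomial (Fin n) K) :
    f ∈ (mx x).asIdeal ↔ eval x f = 0 := RingHom.mem_ker

lemma exists_chain (x : Fin n → K) : ∃ p, HasChain p (mx x) n := by
  let e : ℕ → (MvPolynomial (Fin n) K →ₐ[K] MvPolynomial (Fin n) K) := fun j =>
    aeval (fun i => if (i : ℕ) < j then C (x i) else X i)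
  let q : ℕ → PrimeSpectrum (MvPolynomial (Fin n) K) := fun j =>
    ⟨RingHom.ker (e j), RingHom.ker_isPrime _⟩
  have hcomp : ∀ j, (e (j+1)).comp (e j) = e (j+1) := by
    intro j
    ext1 i
    simp only [e, AlgHom.comp_apply, aeval_X]
    split_ifs with h1 h2
    · rw [← algebraMap_eq, AlgHom.commutes]
    · omega
    · rw [aeval_X, if_pos (by omega)]
    · rw [aeval_X, if_neg (by omega)]
  have hlt : ∀ j, j < n → q j < q (j + 1) := by
    intro j hj
    refine lt_of_le_of_ne ?_ ?_
    · intro f hf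
      have hf' : e j f = 0 := hf
      change e (j+1) f = 0
      rw [← hcomp j, AlgHom.comp_apply, hf', map_zero]
    · intro h
      have h1 : (X ⟨j, hj⟩ - C (x ⟨j, hj⟩) : MvPolynomial (Fin n) K) ∈ (q (j+1)).asIdeal := by
        change e (j+1) _ = 0
        simp [e]
      rw [← h] at h1
      have h2 : e j (X ⟨j, hj⟩ - C (x ⟨j, hj⟩)) = 0 := h1
      simp only [e, map_sub, aeval_X, lt_irrefl, if_false] at h2
      rw [← algebraMap_eq, AlgHom.commutes, algebraMap_eq] at h2
      have h3 := congrArg (eval (fun i => x i + 1)) h2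
      simp at h3
  let l : LTSeries (PrimeSpectrum (MvPolynomial (Fin n) K)) :=
    { length := n
      toFun := fun i => q i
      step := fun i => by
        have := hlt i i.2
        simpa using this }
  refine ⟨l.head, l, rfl, ?_, rfl⟩
  change q n = mx x
  ext f
  rw [mem_mx]
  change e n f = 0 ↔ _
  have h1 : e n f = C (eval x f) := by
    have : e n = (Algebra.ofId K (MvPolynomial (Fin n) K)).comp (aeval x) := by
      ext1 i
      simp [e, Algebra.ofId_apply]
    rw [this]
    simp [Algebra.ofId_apply]
  rw [h1, C_eq_zero]

variable {ι : Type*} [Fintype ι]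

lemma interp [DecidableEq ι] (x : ι → Fin n → K) (hx : Function.Injective x) (i : ι) :
    ∃ g : MvPolynomial (Fin n) K, ∀ j, eval (x j) g = if j = i then 1 else 0 := by
  have h : ∀ j, ∃ g : MvPolynomial (Fin n) K, j ≠ i → eval (x i) g = 1 ∧ eval (x j) g = 0 := by
    intro j
    by_cases hj : j = i
    · exact ⟨0, fun h => absurd hj h⟩
    obtain ⟨t, ht⟩ : ∃ t, x j t ≠ x i t := by
      by_contra! hc
      exact hj (hx (funext hc))
    refine ⟨C (x i t - x j t)⁻¹ * (X t - C (x j t)), fun _ => ⟨?_, by simp⟩⟩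
    simp only [map_mul, map_sub, eval_C, eval_X]
    exact inv_mul_cancel₀ (sub_ne_zero.2 ht.symm)
  choose g hg using h
  refine ⟨∏ j ∈ Finset.univ.erase i, g j, fun j => ?_⟩
  rw [map_prod]
  split_ifs with h
  · subst h
    exact Finset.prod_eq_one fun l hl => (hg l (Finset.ne_of_mem_erase hl)).1
  · exact Finset.prod_eq_zero (Finset.mem_erase.2 ⟨h, Finset.mem_univ j⟩) (hg j h).2

lemma base_case (x : ι → Fin n → K) (hx : Function.Injective x)
    (I : Ideal (MvPolynomial (Fin n) K)) (hI : ∀ i, I ≤ (mx (x i)).asIdeal) :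
    ∃ m0, ∀ t, Fintype.card ι ≤ H I (m0 + t) := by
  classical
  choose g hg using interp x hx
  refine ⟨Finset.univ.sup fun i => (g i).totalDegree, fun t => ?_⟩
  set m := (Finset.univ.sup fun i => (g i).totalDegree) + t
  have hm : ∀ i, (g i).totalDegree ≤ m := fun i =>
    (Finset.le_sup (f := fun i => (g i).totalDegree) (Finset.mem_univ i)).trans
      (Nat.le_add_right _ _)
  let φ : (MvPolynomial (Fin n) K ⧸ I) →ₐ[K] (ι → K) :=
    Ideal.Quotient.liftₐ I (AlgHom.pi fun i => aeval (x i)) (by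
      intro a ha
      funext i
      have := (mem_mx _ _).1 (hI i ha)
      simp only [AlgHom.pi_apply, aeval_eq_eval]
      exact this)
  let w : ι → W I m := fun i => ⟨Ideal.Quotient.mk I (g i), mem_W (hm i)⟩
  have hw : LinearIndependent K w := by
    apply LinearIndependent.of_comp (φ.toLinearMap ∘ₗ (W I m).subtype)
    have : (φ.toLinearMap ∘ₗ (W I m).subtype) ∘ w = fun i => Pi.single i (1 : K) := by
      funext i j
      change (AlgHom.pi fun i => aeval (x i)) (g i) j = _
      have := hg i j
      simp only [AlgHom.pi_apply, Pi.single_apply, aeval_eq_eval]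
      exact this
    rw [this]
    exact Pi.linearIndependent_single_one ι K
  exact hw.fintype_card_le_finrank

lemma nzd {A : Type*} [CommRing A] (p : ι → PrimeSpectrum A) (f : A)
    (hf : ∀ i, f ∉ (p i).asIdeal) (a : A) (h : f * a ∈ ⨅ i, (p i).asIdeal) :
    a ∈ ⨅ i, (p i).asIdeal := by
  rw [Ideal.mem_iInf] at h ⊢
  exact fun i => ((p i).2.mem_or_mem (h i)).resolve_left (hf i)

/-- bounding property -/
def Good (p : ι → PrimeSpectrum (MvPolynomial (Fin n) K)) (r D : ℕ) : Prop :=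
  ∃ m0, ∀ t, Fintype.card ι * t ^ r ≤ H (⨅ i, (p i).asIdeal) (m0 + t) * (D * r.factorial)

lemma good_step (x : ι → Fin n → K) (p : ι → PrimeSpectrum (MvPolynomial (Fin n) K))
    (r d D : ℕ) (hp : ∀ i, HasChain (p i) (mx (x i)) (r + 1)) (f : MvPolynomial (Fin n) K)
    (hd : f.totalDegree ≤ d) (hf : ∀ i, f ∉ (p i).asIdeal) (hfx : ∀ i, f ∈ (mx (x i)).asIdeal)
    (h : ∀ p' : ι → PrimeSpectrum (MvPolynomial (Fin n) K), (∀ i, p i ≤ p' i) →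
      (∀ i, f ∈ (p' i).asIdeal) → (∀ i, HasChain (p' i) (mx (x i)) r) → Good p' r D) :
    Good p (r + 1) (d * D) := by
  choose p' h1 h2 h3 using fun i => (hp i).cut (hfx i)
  refine growth _ _ _ D d r ?_ (h p' h1 h2 h3)
  refine H_step _ _ f d ?_ ?_ hd (nzd p f hf)
  · exact iInf_mono h1
  · rw [Ideal.mem_iInf]; exact h2

lemma exists_gen [Infinite K] {A : Type*} [CommRing A] [Algebra K A]
    (p : ι → Ideal A) (g : Fin n → A) (h : ∀ i, ∃ j, g j ∉ p i) :
    ∃ a : Fin n → K, ∀ i, ∑ j, a j • g j ∉ p i := by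
  classical
  let L : (Fin n → K) →ₗ[K] A := Fintype.linearCombination K g
  let V : ι → Subspace K (Fin n → K) := fun i => ((p i).restrictScalars K).comap L
  by_contra! hc
  have : ⋃ i, (V i : Set (Fin n → K)) = Set.univ := by
    refine Set.eq_univ_of_forall fun a => ?_
    obtain ⟨i, hi⟩ := hc a
    exact Set.mem_iUnion.2 ⟨i, hi⟩
  obtain ⟨i, hi⟩ := Subspace.exists_eq_top_of_iUnion_eq_univ this
  obtain ⟨j, hj⟩ := h i
  have h1 : Pi.single j (1 : K) ∈ V i := by rw [hi]; trivial
  have h2 : L (Pi.single j (1 : K)) ∈ p i := h1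
  simp [L] at h2
  exact hj h2

lemma eq_mx (x : Fin n → K) (p : PrimeSpectrum (MvPolynomial (Fin n) K)) (hp : p ≤ mx x)
    (F : Finset K) (h : ∀ j, ∏ a ∈ F, (X j - C a) ∈ p.asIdeal) : p = mx x := by
  have h1 : ∀ j, X j - C (x j) ∈ p.asIdeal := by
    intro j
    obtain ⟨a, -, ha⟩ := (p.2.prod_mem_iff).1 (h j)
    have := (mem_mx _ _).1 (hp ha)
    simp [sub_eq_zero] at this
    rwa [this]
  refine le_antisymm hp ?_
  intro f hf
  have hf := (mem_mx _ _).1 hf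
  rw [← Ideal.Quotient.eq_zero_iff_mem]
  have h2 : Ideal.Quotient.mkₐ K p.asIdeal
      = (Algebra.ofId K (MvPolynomial (Fin n) K ⧸ p.asIdeal)).comp (aeval x) := by
    ext1 j
    have := Ideal.Quotient.eq.2 (h1 j)
    simp only [Ideal.Quotient.mkₐ_eq_mk, AlgHom.comp_apply, aeval_X]
    exact this
  have h3 := DFunLike.congr_fun h2 f
  rw [AlgHom.comp_apply, aeval_eq_eval] at h3
  change Ideal.Quotient.mk _ f = _ at h3
  rw [h3]
  change Algebra.ofId K _ (eval x f) = 0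
  rw [hf, map_zero]

lemma q_phase [Infinite K] (x : ι → Fin n → K) (hx : Function.Injective x) (F : Finset K)
    (hF : ∀ i j, x i j ∈ F) (r : ℕ) : ∀ (p : ι → PrimeSpectrum (MvPolynomial (Fin n) K)),
    (∀ i, HasChain (p i) (mx (x i)) r) → Good p r (F.card ^ r) := by
  induction r with
  | zero =>
    intro p hp
    obtain ⟨m0, h⟩ := base_case x hx (⨅ i, (p i).asIdeal)
      (fun i => (iInf_le _ i).trans (hp i).le)
    exact ⟨m0, fun t => by simpa using h t⟩
  | succ r ih =>
    intro p hp
    obtain ⟨a, ha⟩ := exists_gen (K := K) (fun i => (p i).asIdeal)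
      (fun j : Fin n => ∏ a ∈ F, (X j - C a : MvPolynomial (Fin n) K)) (by
        intro i
        by_contra! hc
        exact (hp i).ne (eq_mx (x i) (p i) (hp i).le F hc))
    rw [pow_succ']
    refine good_step x p r F.card _ hp _ ?_ ha ?_ (fun p' _ _ h => ih p' h)
    · refine totalDegree_finsetSum_le fun j _ => (totalDegree_smul_le _ _).trans ?_
      refine (totalDegree_finsetProd _ _).trans ?_
      refine (Finset.sum_le_card_nsmul _ _ 1 fun b _ => ?_).trans (by simp)
      exact (totalDegree_sub_C_le _ _).trans (totalDegree_X _).le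
    · intro i
      rw [mem_mx, map_sum]
      refine Finset.sum_eq_zero fun j _ => ?_
      rw [smul_eval, map_prod, Finset.prod_eq_zero (hF i j) (by simp), mul_zero]

lemma p_phase [Infinite K] (x : ι → Fin n → K) (hx : Function.Injective x) (F : Finset K)
    (hF : ∀ i j, x i j ∈ F) (r : ℕ) (T : Set (MvPolynomial (Fin n) K))
    (hT : ∀ i (p : PrimeSpectrum (MvPolynomial (Fin n) K)), T ⊆ p.asIdeal →
      ¬ HasChain p (mx (x i)) (r + 1)) (L : List (MvPolynomial (Fin n) K)) :
    (∀ f ∈ L, ∀ i, eval (x i) f = 0) →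
    ∀ (p : ι → PrimeSpectrum (MvPolynomial (Fin n) K)),
    (∀ i, HasChain (p i) (mx (x i)) (r + L.length)) →
    (∀ f ∈ T, f ∈ L ∨ ∀ i, f ∈ (p i).asIdeal) →
    Good p (r + L.length) ((L.map totalDegree).prod * F.card ^ r) := by
  induction L with
  | nil =>
    intro _ p hp _
    simpa using q_phase x hx F hF r p hp
  | cons f L ih =>
    intro h0 p hp hm
    rw [List.map_cons, List.prod_cons, mul_assoc]
    refine good_step x p (r + L.length) _ _ hp f le_rfl ?_ (fun i => (mem_mx _ _).2 (h0 f (by simp) i)) ?_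
    · intro i hfi
      obtain ⟨p', h1, h2, h3⟩ := HasChain.cutList (r := r + 1) L (p := p i) (m := mx (x i))
        (by have := hp i; rw [List.length_cons] at this; convert this using 1; ring)
        (fun g hg => (mem_mx _ _).2 (h0 g (by simp [hg]) i))
      refine hT i p' ?_ h3
      intro g hg
      rcases hm g hg with h | h
      · rcases List.mem_cons.1 h with rfl | h
        · exact h1 hfi
        · exact h2 g h
      · exact h1 (h i)
    · intro p' h1 h2 h3
      refine ih (fun g hg => h0 g (by simp [hg])) p' h3 ?_
      intro g hg
      rcases hm g hg with h | h
      · rcases List.mem_cons.1 h with rfl | h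
        · exact Or.inr h2
        · exact Or.inl h
      · exact Or.inr fun i => h1 i (h i)

lemma Good.le {p : ι → PrimeSpectrum (MvPolynomial (Fin n) K)} {D : ℕ} (h : Good p n D) :
    Fintype.card ι ≤ D := by
  obtain ⟨m0, h⟩ := h
  refine final_le _ D (m0 + n) n fun t => (h t).trans ?_
  calc _ = D * (H (⨅ i, (p i).asIdeal) (m0 + t) * n.factorial) := by ring
    _ ≤ D * (m0 + t + n) ^ n := by gcongr; exact H_le _ _
    _ = _ := by congr 2; ring

end
end Bez

/-- Let k = 𝔽_q and P₁,…,P_c ∈ k[x₁,…,x_n] polynomials of degrees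
d₁,…,d_c whose common zero locus over the algebraic closure K has dimension n − c
(i.e. the coordinate ring K[x]/I has Krull dimension n − c).  Then the number of
𝔽_q-rational points is at most q^{n-c} · ∏ d_i. -/
theorem stmt12 {k : Type*} [Field k] [Fintype k] (n c : ℕ) (hc : c ≤ n)
    (d : Fin c → ℕ) (P : Fin c → MvPolynomial (Fin n) k)
    (hdeg : ∀ i, (P i).totalDegree = d i)
    (hdim :
      ringKrullDim
        (MvPolynomial (Fin n) (AlgebraicClosure k) ⧸
          Ideal.span (Set.range fun i =>
            MvPolynomial.map (algebraMap k (AlgebraicClosure k)) (P i)))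
        = (n - c : ℕ)) :
    Nat.card {x : Fin n → k // ∀ i, MvPolynomial.eval x (P i) = 0}
      ≤ Fintype.card k ^ (n - c) * ∏ i, d i := by
  classical
  let K := AlgebraicClosure k
  let ι := {x : Fin n → k // ∀ i, MvPolynomial.eval x (P i) = 0}
  let pt : ι → Fin n → K := fun x j => algebraMap k K (x.1 j)
  have hpt : Function.Injective pt := by
    intro a b hab
    apply Subtype.ext
    funext j
    exact (algebraMap k K).injective (congrFun hab j)
  let F : Finset K := Finset.univ.image (algebraMap k K)
  have hFc : F.card = Fintype.card k :=
    Finset.card_image_of_injective _ (algebraMap k K).injective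
  have hF : ∀ (i : ι) j, pt i j ∈ F := fun i j =>
    Finset.mem_image_of_mem _ (Finset.mem_univ _)
  let Q : Fin c → MvPolynomial (Fin n) K := fun i => MvPolynomial.map (algebraMap k K) (P i)
  have hQd : ∀ i, (Q i).totalDegree = d i := by
    intro i
    rw [← hdeg i]
    simp only [Q, totalDegree]
    rw [support_map_of_injective _ (algebraMap k K).injective]
  have hQ0 : ∀ i (a : ι), eval (pt a) (Q i) = 0 := by
    intro i a
    have h1 : eval (pt a) (Q i) = algebraMap k K (eval a.1 (P i)) := by
      simp only [Q, pt]
      rw [eval_map]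
      exact (eval₂_comp (algebraMap k K) a.1 (P i)).symm
    rw [h1, a.2 i, map_zero]
  choose p hp using fun a : ι => Bez.exists_chain (pt a)
  have key := Bez.p_phase pt hpt F hF (n - c) (Set.range Q) (by
    intro a p' hp' hch
    have h1 := hch.le_dim (I := Ideal.span (Set.range Q)) (Ideal.span_le.2 hp')
    rw [hdim] at h1
    have h2 : (n - c) + 1 ≤ n - c := by exact_mod_cast h1
    omega) (List.ofFn Q) (by
      intro f hf a
      obtain ⟨i, rfl⟩ := (List.mem_ofFn' _ _).1 hf
      exact hQ0 i a) p (by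
      intro a
      have := hp a
      rw [List.length_ofFn, Nat.sub_add_cancel hc]
      exact this) (by
      intro f hf
      exact Or.inl ((List.mem_ofFn' _ _).2 hf))
  rw [List.length_ofFn, Nat.sub_add_cancel hc] at key
  have := key.le
  rw [List.map_ofFn, List.prod_ofFn, hFc] at this
  rw [Nat.card_eq_fintype_card, mul_comm]
  refine this.trans (le_of_eq ?_)
  congr 1
  exact Finset.prod_congr rfl fun i _ => hQd i
end

section
/- Let k = 𝔽_q with q > a·D where D = ∏ d_i, and let P̄ = (P₁,…,P_c) be polynomials of degrees d₁,…,d_c on k^n such that the scheme X = {P₁=⋯=P_c=0} is an irreducible complete intersection of dimension n−c and satisfies |X(𝔽_q)| > q^{n-c}(q−1)/q. Then any polynomial R of degree a with R(x) = 0 for all x ∈ X(𝔽_q) belongs to the ideal (P₁,…,P_c). -/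
open MvPolynomial

namespace BezoutAux

/-- maximal ideal of a point -/
noncomputable abbrev ptIdeal {K : Type*} [Field K] {n : ℕ} (x : Fin n → K) :
    Ideal (MvPolynomial (Fin n) K) := RingHom.ker (eval x : MvPolynomial (Fin n) K →+* K)

lemma ptIdeal_isMaximal {K : Type*} [Field K] {n : ℕ} (x : Fin n → K) :
    (ptIdeal x).IsMaximal :=
  RingHom.ker_isMaximal_of_surjective _ (fun a => ⟨C a, by simp⟩)

lemma avoid {K V : Type*} [Field K] [Infinite K] [AddCommGroup V] [Module K V]
    (W : Submodule K V) (T : Set (Submodule K V)) (hT : T.Finite) (h : ∀ p ∈ T, ¬ W ≤ p) :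
    ∃ w ∈ W, ∀ p ∈ T, w ∉ p := by
  classical
  by_contra! hcon
  have := hT.to_subtype
  have hc : ⋃ i : T, (((i : Submodule K V).comap W.subtype : Subspace K W) : Set W) = Set.univ := by
    ext w
    simp only [Set.mem_iUnion, Set.mem_univ, iff_true]
    obtain ⟨p, hp, hw⟩ := hcon w.1 w.2
    exact ⟨⟨p, hp⟩, hw⟩
  obtain ⟨i, hi⟩ := Subspace.exists_eq_top_of_iUnion_eq_univ hc
  apply h i.1 i.2
  intro w hw
  have : (⟨w, hw⟩ : W) ∈ (i : Submodule K V).comap W.subtype := by rw [hi]; trivial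
  exact this

lemma arith (h h' : ℕ → ℕ) (hm : Monotone h') (d : ℕ) (hd : 1 ≤ d)
    (h1 : ∀ t, h' t ≤ h t) (h2 : ∀ t, h' (t + d) + h t ≤ h (t + d)) (t : ℕ) :
    ∑ y ∈ Finset.range (t + 1), h' y ≤ d * h t := by
  induction t using Nat.strong_induction_on with
  | _ t ih =>
    by_cases ht : t < d
    · calc ∑ y ∈ Finset.range (t + 1), h' y ≤ ∑ y ∈ Finset.range (t + 1), h' t :=
            Finset.sum_le_sum fun y hy => hm (by simp at hy; omega)
        _ = (t + 1) * h' t := by simp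
        _ ≤ d * h t := Nat.mul_le_mul ht (h1 t)
    · obtain ⟨u, rfl⟩ : ∃ u, t = u + d := ⟨t - d, by omega⟩
      rw [show u + d + 1 = (u + 1) + d by ring, Finset.sum_range_add]
      have := ih u (by omega)
      have h3 : ∑ y ∈ Finset.range d, h' (u + 1 + y) ≤ d * h' (u + d) := by
        calc _ ≤ ∑ y ∈ Finset.range d, h' (u + d) :=
              Finset.sum_le_sum fun y hy => hm (by simp at hy; omega)
          _ = _ := by simp
      have h4 := Nat.mul_le_mul_left d (h2 u)
      rw [mul_add] at h4
      omega

lemma asymp (N D s n : ℕ)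
    (h : ∀ t, N * (t + n).choose n ≤ D * (t + s + n).choose n) : N ≤ D := by
  have h1 : ∀ t : ℕ, N * (t + 1) ^ n ≤ D * (t + s + n) ^ n := by
    intro t
    have a1 : (t + 1) ^ n ≤ n.factorial * (t + n).choose n := by
      rw [← Nat.ascFactorial_eq_factorial_mul_choose]
      exact Nat.pow_succ_le_ascFactorial (t+1) n
    have a2 : n.factorial * (t + s + n).choose n ≤ (t + s + n) ^ n := by
      rw [← Nat.descFactorial_eq_factorial_mul_choose]
      exact Nat.descFactorial_le_pow _ _
    calc N * (t + 1) ^ n ≤ N * (n.factorial * (t + n).choose n) := Nat.mul_le_mul_left _ a1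
      _ = n.factorial * (N * (t + n).choose n) := by ring
      _ ≤ n.factorial * (D * (t + s + n).choose n) := Nat.mul_le_mul_left _ (h t)
      _ = D * (n.factorial * (t + s + n).choose n) := by ring
      _ ≤ _ := Nat.mul_le_mul_left _ a2
  have lim : Filter.Tendsto (fun t : ℕ => (D : ℝ) * (1 + ((s + n : ℕ) : ℝ) / ((t : ℝ) + 1)) ^ n)
      Filter.atTop (nhds ((D : ℝ) * (1 + 0) ^ n)) := by
    refine Filter.Tendsto.const_mul _ (Filter.Tendsto.pow (Filter.Tendsto.const_add _ ?_) _)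
    exact tendsto_const_div_atTop_nhds_zero_nat ((s + n : ℕ) : ℝ) |>.comp (Filter.tendsto_add_atTop_nat 1)
      |>.congr (by intro t; simp)
  have : (N : ℝ) ≤ (D : ℝ) * (1 + 0) ^ n := by
    refine ge_of_tendsto' lim fun t => ?_
    have ht : (0 : ℝ) < ((t : ℝ) + 1) ^ n := by positivity
    have h2 : (N : ℝ) * ((t : ℝ) + 1) ^ n ≤ D * ((t : ℝ) + s + n) ^ n := by exact_mod_cast h1 t
    have h3 : (1 + ((s + n : ℕ) : ℝ) / ((t : ℝ) + 1)) ^ n * ((t : ℝ) + 1) ^ n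
        = ((t : ℝ) + 1 + s + n) ^ n := by
      rw [← mul_pow]; congr 1; field_simp; push_cast; ring
    refine le_of_mul_le_mul_right ?_ ht
    rw [mul_assoc, h3]
    refine h2.trans ?_
    gcongr; linarith
  simpa using this

lemma finrank_le (K : Type*) [Field K] (n t : ℕ) :
    Module.finrank K (restrictTotalDegree (Fin n) K t) ≤ (t + n).choose n := by
  classical
  have e : Module.finrank K (restrictTotalDegree (Fin n) K t) =
      Nat.card {m : Fin n →₀ ℕ | (m.sum fun _ e => e) ≤ t} :=
    Module.finrank_eq_nat_card_basis (basisRestrictSupport K _)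
  rw [e]
  have : {m : Fin n →₀ ℕ | (m.sum fun _ e => e) ≤ t} ⊆
      (((Finset.range (t + 1)).biUnion fun i => (Finset.univ : Finset (Fin n)).finsuppAntidiag i) :
        Finset (Fin n →₀ ℕ)) := by
    intro m hm
    simp only [Set.mem_ofPred_eq] at hm
    rw [Finsupp.sum_fintype _ _ (by simp)] at hm
    simp [Finset.mem_finsuppAntidiag]
    omega
  have h2 := Nat.card_mono (Finset.finite_toSet _) this
  refine h2.trans ?_
  rw [Nat.card_eq_card_toFinset, Finset.toFinset_coe]
  refine Finset.card_biUnion_le.trans ?_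
  simp only [Finset.card_finsuppAntidiag_nat_eq_multichoose, Finset.card_univ, Fintype.card_fin]
  cases n with
  | zero =>
    rw [Finset.sum_range_succ']
    simp [Nat.multichoose_zero_succ]
  | succ n =>
    rw [← add_assoc, ← Nat.sum_range_add_choose]
    refine le_of_eq (Finset.sum_congr rfl fun i _ => ?_)
    rw [Nat.multichoose_eq]
    rw [show n + 1 + i - 1 = i + n by omega, ← Nat.choose_symm_add]

lemma height_pt {K : Type*} [Field K] {n : ℕ} (x : Fin n → K) : (n : ℕ∞) ≤ (ptIdeal x).height := by
  let φ : ℕ → MvPolynomial (Fin n) K →ₐ[K] MvPolynomial (Fin n) K := fun j =>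
    aeval (fun i : Fin n => if (i : ℕ) < j then C (x i) else X i)
  have key : ∀ j ≤ n, (j : ℕ∞) ≤ (RingHom.ker (φ j)).height := by
    intro j
    induction j with
    | zero => simp
    | succ j ih =>
      intro hj
      have h1 := ih (by omega)
      have p1 : (RingHom.ker (φ j)).IsPrime := RingHom.ker_isPrime _
      have p2 : (RingHom.ker (φ (j+1))).IsPrime := RingHom.ker_isPrime _
      have hlt : RingHom.ker (φ j) < RingHom.ker (φ (j+1)) := by
        refine lt_of_le_of_ne ?_ ?_
        · have : φ (j+1) = (φ (j+1)).comp (φ j) := by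
            apply MvPolynomial.algHom_ext
            intro i
            simp only [φ, AlgHom.comp_apply, aeval_X]
            split_ifs with h1 h2 h3
            · simp [algHom_C]
            · simp; omega
            · omega
            · simp; omega
          intro f hf
          rw [RingHom.mem_ker] at hf ⊢
          rw [this, AlgHom.comp_apply, hf, map_zero]
        · intro h
          have : (X ⟨j, hj⟩ - C (x ⟨j, hj⟩) : MvPolynomial (Fin n) K) ∈ RingHom.ker (φ (j+1)) := by
            simp [RingHom.mem_ker, φ, algHom_C]
          rw [← h] at this
          simp only [RingHom.mem_ker, φ, map_sub, aeval_X, algHom_C] at this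
          simp at this
          have h3 := congrArg totalDegree (sub_eq_zero.mp this)
          simp at h3
      have := Ideal.height_add_one_le_of_lt_of_isPrime hlt
      push_cast
      exact (add_le_add_left h1 1).trans this
  refine (key n le_rfl).trans (Ideal.height_mono ?_)
  intro f hf
  rw [RingHom.mem_ker] at hf ⊢
  have : (aeval x : MvPolynomial (Fin n) K →ₐ[K] K) = (aeval x).comp (φ n) := by
    apply MvPolynomial.algHom_ext
    intro i
    simp [φ]
  have h2 := congrArg (fun g => g f) this
  simp only [AlgHom.comp_apply, hf, map_zero] at h2
  simpa [aeval_eq_eval] using h2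

end BezoutAux
namespace BezoutAux

section hilb
variable {K : Type*} [Field K] {n : ℕ}

/-- image of the polynomials of degree at most t in the quotient -/
noncomputable def fil (J : Ideal (MvPolynomial (Fin n) K)) (t : ℕ) :
    Submodule K (MvPolynomial (Fin n) K ⧸ J) :=
  (restrictTotalDegree (Fin n) K t).map (Ideal.Quotient.mkₐ K J).toLinearMap

/-- affine Hilbert function -/
noncomputable def hf (J : Ideal (MvPolynomial (Fin n) K)) (t : ℕ) : ℕ :=
  Module.finrank K (fil J t)

instance (J : Ideal (MvPolynomial (Fin n) K)) (t : ℕ) : Module.Finite K (fil J t) := by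
  unfold fil; infer_instance

lemma fil_mono (J : Ideal (MvPolynomial (Fin n) K)) {s t : ℕ} (h : s ≤ t) :
    fil J s ≤ fil J t := by
  refine Submodule.map_mono fun f hf => ?_
  rw [mem_restrictTotalDegree] at *
  omega

lemma hf_mono (J : Ideal (MvPolynomial (Fin n) K)) : Monotone (hf J) := fun _ _ h =>
  Submodule.finrank_mono (fil_mono J h)

lemma hf_le (J : Ideal (MvPolynomial (Fin n) K)) (t : ℕ) : hf J t ≤ (t + n).choose n :=
  (Submodule.finrank_map_le _ _).trans (finrank_le K n t)

lemma fil_map {J J' : Ideal (MvPolynomial (Fin n) K)} (h : J ≤ J') (t : ℕ) :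
    (fil J t).map (Ideal.Quotient.factorₐ K h).toLinearMap = fil J' t := by
  unfold fil
  rw [← Submodule.map_comp]
  rfl

lemma hf_anti {J J' : Ideal (MvPolynomial (Fin n) K)} (h : J ≤ J') (t : ℕ) :
    hf J' t ≤ hf J t := by
  unfold hf
  rw [← fil_map h]
  exact Submodule.finrank_map_le _ _

lemma hf_step {J J' : Ideal (MvPolynomial (Fin n) K)} (h : J ≤ J')
    (w : MvPolynomial (Fin n) K) (hw : w ∈ J') (d : ℕ) (hd : w.totalDegree ≤ d)
    (hnz : ∀ f, w * f ∈ J → f ∈ J) (t : ℕ) : hf J' (t + d) + hf J t ≤ hf J (t + d) := by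
  let ψ : fil J (t + d) →ₗ[K] (MvPolynomial (Fin n) K ⧸ J') :=
    (Ideal.Quotient.factorₐ K h).toLinearMap.domRestrict (fil J (t + d))
  have hr : Module.finrank K (LinearMap.range ψ) = hf J' (t + d) := by
    rw [LinearMap.range_domRestrict, fil_map h]; rfl
  have hrn := LinearMap.finrank_range_add_finrank_ker ψ
  let μ : (MvPolynomial (Fin n) K ⧸ J) →ₗ[K] (MvPolynomial (Fin n) K ⧸ J) :=
    LinearMap.mulLeft K (Ideal.Quotient.mk J w)
  have hinj : Function.Injective μ := by
    rw [injective_iff_map_eq_zero]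
    intro a ha
    obtain ⟨f, rfl⟩ := Ideal.Quotient.mk_surjective a
    simp only [μ, LinearMap.mulLeft_apply, ← map_mul] at ha
    rw [Ideal.Quotient.eq_zero_iff_mem] at ha ⊢
    exact hnz f ha
  have hle : (fil J t).map μ ≤ (LinearMap.ker ψ).map (fil J (t + d)).subtype := by
    rintro _ ⟨_, ⟨f, hf, rfl⟩, rfl⟩
    have hf' : f.totalDegree ≤ t := (mem_restrictTotalDegree _ _ _).1 hf
    refine ⟨⟨_, ⟨w * f, ?_, rfl⟩⟩, ?_, ?_⟩
    · refine (mem_restrictTotalDegree _ _ _).2 ((totalDegree_mul _ _).trans (by omega))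
    · show Ideal.Quotient.mk J' (w * f) = 0
      rw [Ideal.Quotient.eq_zero_iff_mem]
      exact J'.mul_mem_right _ hw
    · simp [μ]
  have h1 := Submodule.finrank_mono hle
  rw [← (Submodule.equivMapOfInjective μ hinj _).finrank_eq] at h1
  have h2 := Submodule.finrank_map_le (fil J (t + d)).subtype (LinearMap.ker ψ)
  unfold hf at *
  omega

lemma interp (S : Finset (Fin n → K)) : ∃ s₀ : ℕ, ∀ J : Ideal (MvPolynomial (Fin n) K),
    (∀ x ∈ S, J ≤ ptIdeal x) → S.card ≤ hf J s₀ := by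
  classical
  have ex : ∀ x : Fin n → K, ∃ f : MvPolynomial (Fin n) K, eval x f ≠ 0 ∧
      ∀ y ∈ S, y ≠ x → eval y f = 0 := by
    intro x
    have : ∀ y : Fin n → K, ∃ g : MvPolynomial (Fin n) K, y ≠ x → eval x g ≠ 0 ∧ eval y g = 0 := by
      intro y
      by_cases hy : y = x
      · exact ⟨0, fun h => absurd hy h⟩
      · obtain ⟨i, hi⟩ := Function.ne_iff.mp hy
        exact ⟨X i - C (y i), fun _ => ⟨by simpa [sub_eq_zero] using fun h => hi h.symm, by simp⟩⟩
    choose g hg using this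
    refine ⟨∏ y ∈ S.erase x, g y, ?_, ?_⟩
    · rw [map_prod, Finset.prod_ne_zero_iff]
      intro y hy
      exact (hg y (Finset.mem_erase.1 hy).1).1
    · intro y hy hyx
      rw [map_prod]
      exact Finset.prod_eq_zero (Finset.mem_erase.2 ⟨hyx, hy⟩) (hg y hyx).2
  choose f hf0 hf1 using ex
  refine ⟨S.sup fun x => (f x).totalDegree, fun J hJ => ?_⟩
  let v : S → fil J (S.sup fun x => (f x).totalDegree) := fun x =>
    ⟨Ideal.Quotient.mk J (f x), ⟨f x, (mem_restrictTotalDegree _ _ _).2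
      (Finset.le_sup (f := fun x => (f x).totalDegree) x.2), rfl⟩⟩
  have hv : LinearIndependent K v := by
    rw [Fintype.linearIndependent_iff]
    intro c hc x
    have h1 : Ideal.Quotient.mk J (∑ y : S, C (c y) * f y) = 0 := by
      have hC : ∀ (a : K) (f : MvPolynomial (Fin n) K), Ideal.Quotient.mk J (C a) *
          Ideal.Quotient.mk J f = a • Ideal.Quotient.mk J f := by
        intro a f
        rw [← map_mul, ← smul_eq_C_mul]; rfl
      have := congrArg Subtype.val hc
      rw [map_sum]
      simp only [map_mul, hC]
      simpa [v] using this
    rw [Ideal.Quotient.eq_zero_iff_mem] at h1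
    have h2 := hJ x x.2 h1
    rw [RingHom.mem_ker, map_sum, Finset.sum_eq_single x] at h2
    · simpa [hf0] using h2
    · intro y _ hy
      simp [hf1 y x x.2 (fun h => hy (Subtype.ext h.symm))]
    · simp
  have := hv.fintype_card_le_finrank
  simpa [hf] using this

/-- the intersection of primes containing F and contained in the ideal of a point in S -/
noncomputable def locI (S : Finset (Fin n → K)) (F : Finset (MvPolynomial (Fin n) K)) :
    Ideal (MvPolynomial (Fin n) K) :=
  sInf {p | p.IsPrime ∧ (F : Set (MvPolynomial (Fin n) K)) ⊆ p ∧ ∃ x ∈ S, p ≤ ptIdeal x}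

lemma bezout_aux [Infinite K] (S : Finset (Fin n → K)) (s₀ : ℕ)
    (hs : ∀ J : Ideal (MvPolynomial (Fin n) K), (∀ x ∈ S, J ≤ ptIdeal x) → S.card ≤ hf J s₀)
    (hne : S.Nonempty)
    (l : List (MvPolynomial (Fin n) K)) :
    ∀ (F : Finset (MvPolynomial (Fin n) K)), F.card + l.length ≤ n →
    l.Pairwise (fun a b => b.totalDegree ≤ a.totalDegree) →
    (∀ x ∈ S, ptIdeal x ∈ (Ideal.span ((F : Set _) ∪ {f | f ∈ l})).minimalPrimes) →
    ∀ t, S.card * (t + l.length).choose l.length ≤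
      (l.map totalDegree).prod * hf (locI S F) (t + s₀) := by
  classical
  induction l with
  | nil =>
    intro F _ _ hmin t
    have := hs (locI S F) (fun x hx => sInf_le ⟨(ptIdeal_isMaximal x).isPrime, by
      intro f hf
      exact (hmin x hx).1.2 (Ideal.subset_span (Or.inl hf)), x, hx, le_rfl⟩)
    simpa using this.trans (hf_mono _ (by omega))
  | cons g l ih =>
    intro F hcard hsort hmin t
    let W : Submodule K (MvPolynomial (Fin n) K) := Submodule.span K {f | f ∈ g :: l}
    let T1 : Set (Ideal (MvPolynomial (Fin n) K)) :=
      {p | p ∈ (Ideal.span (F : Set (MvPolynomial (Fin n) K))).minimalPrimes ∧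
        ∃ x ∈ S, p ≤ ptIdeal x}
    have hT1 : T1.Finite :=
      (Ideal.finite_minimalPrimes_of_isNoetherianRing _ _).subset fun p hp => hp.1
    let L : Submodule K (MvPolynomial (Fin n) K) := Submodule.span K {f | f ∈ l}
    let T : Set (Submodule K (MvPolynomial (Fin n) K)) :=
      (fun p => p.restrictScalars K) '' T1 ∪ {p | p = L ∧ g ∉ L}
    have hT : T.Finite := (hT1.image _).union ((Set.finite_singleton L).subset fun p hp => hp.1)
    obtain ⟨w, hwW, hwT⟩ := avoid W T hT (by
      rintro p (⟨p, ⟨hp, x, hx, hpx⟩, rfl⟩ | ⟨rfl, hg⟩) hW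
      · have hW' : ∀ f ∈ g :: l, f ∈ p := fun f hf => hW (Submodule.subset_span hf)
        have hpp : p.IsPrime := hp.1.1
        have h1 : ptIdeal x ≤ p := (hmin x hx).2 ⟨hpp, by
          rw [Ideal.span_le]
          rintro f (hf | hf)
          · exact hp.1.2 (Ideal.subset_span hf)
          · exact hW' f hf⟩ hpx
        have h2 := (height_pt x).trans (Ideal.height_mono h1)
        have h3 := h2.trans (Ideal.height_le_card_of_mem_minimalPrimes_span_finset hp)
        rw [List.length_cons] at hcard
        have : n ≤ F.card := by exact_mod_cast h3
        omega
      · exact hg (hW (Submodule.subset_span (by simp))))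
    have hw1 : ∀ p ∈ T1, w ∉ p := fun p hp => hwT _ (Or.inl ⟨p, hp, rfl⟩)
    have hw2 : ∃ c : K, ∃ z ∈ L, w = c • g + z := by
      have : W = Submodule.span K {g} ⊔ L := by
        rw [← Submodule.span_union]
        refine congrArg (Submodule.span K) ?_
        ext; simp
      rw [this, Submodule.mem_sup] at hwW
      obtain ⟨y, hy, z, hz, rfl⟩ := hwW
      obtain ⟨c, rfl⟩ := Submodule.mem_span_singleton.1 hy
      exact ⟨c, z, hz, rfl⟩
    have hLI : ∀ I : Ideal (MvPolynomial (Fin n) K), (∀ f ∈ l, f ∈ I) → ∀ z ∈ L, z ∈ I := by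
      intro I hI z hz
      have : L ≤ I.restrictScalars K := Submodule.span_le.2 hI
      exact this hz
    have hwdeg : w.totalDegree ≤ g.totalDegree := by
      have : W ≤ restrictTotalDegree (Fin n) K g.totalDegree := by
        refine Submodule.span_le.2 fun f hf => ?_
        rw [SetLike.mem_coe, mem_restrictTotalDegree]
        rcases List.mem_cons.1 hf with rfl | hf
        · exact le_rfl
        · exact (List.pairwise_cons.1 hsort).1 f hf
      exact (mem_restrictTotalDegree _ _ _).1 (this hwW)
    have hspan : Ideal.span (((insert w F : Finset _) : Set (MvPolynomial (Fin n) K)) ∪ {f | f ∈ l})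
        = Ideal.span ((F : Set _) ∪ {f | f ∈ g :: l}) := by
      obtain ⟨c, z, hz, hwz⟩ := hw2
      apply le_antisymm
      · rw [Ideal.span_le]
        rintro f (hf | hf)
        · rcases Finset.mem_insert.1 hf with rfl | hf
          · rw [hwz, SetLike.mem_coe, Algebra.smul_def]
            refine add_mem (Ideal.mul_mem_left _ _ (Ideal.subset_span (Or.inr (by simp)))) ?_
            exact hLI _ (fun f hf => Ideal.subset_span (Or.inr (List.mem_cons_of_mem _ hf))) z hz
          · exact Ideal.subset_span (Or.inl hf)
        · exact Ideal.subset_span (Or.inr (List.mem_cons_of_mem _ hf))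
      · have hl : ∀ f ∈ l, f ∈ Ideal.span
            (((insert w F : Finset _) : Set (MvPolynomial (Fin n) K)) ∪ {f | f ∈ l}) :=
          fun f hf => Ideal.subset_span (Or.inr hf)
        rw [Ideal.span_le]
        rintro f (hf | hf)
        · exact Ideal.subset_span (Or.inl (by simp [Finset.mem_coe.1 hf]))
        · rcases List.mem_cons.1 hf with rfl | hf
          · by_cases hg : f ∈ L
            · exact hLI _ hl f hg
            · have hwL : w ∉ L := hwT L (Or.inr ⟨rfl, hg⟩)
              have hc : c ≠ 0 := by
                rintro rfl
                rw [zero_smul, zero_add] at hwz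
                exact hwL (hwz ▸ hz)
              have : f = C c⁻¹ * (w - z) := by
                rw [hwz, add_sub_cancel_right, smul_eq_C_mul, ← mul_assoc, ← C_mul,
                  inv_mul_cancel₀ hc, C_1, one_mul]
              rw [this]
              exact Ideal.mul_mem_left _ _ (sub_mem (Ideal.subset_span (Or.inl (by simp)))
                (hLI _ hl z hz))
          · exact hl f hf
    have hIH := ih (insert w F) (by
        have := Finset.card_insert_le w F
        rw [List.length_cons] at hcard
        omega) (List.pairwise_cons.1 hsort).2 (by rw [hspan]; exact hmin)
    have hFle : ∀ p : Ideal (MvPolynomial (Fin n) K), p.IsPrime → (F : Set (MvPolynomial (Fin n) K)) ⊆ p →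
        ∃ q ∈ (Ideal.span (F : Set (MvPolynomial (Fin n) K))).minimalPrimes, q ≤ p := by
      intro p hp hF
      exact Ideal.exists_minimalPrimes_le (Ideal.span_le.2 hF)
    have hJ : locI S F ≤ locI S (insert w F) := by
      refine sInf_le_sInf ?_
      rintro p ⟨hp, hF, hx⟩
      exact ⟨hp, fun f hf => hF (by simp [Finset.mem_coe.1 hf]), hx⟩
    have hwJ : w ∈ locI S (insert w F) := by
      refine Ideal.mem_sInf.2 ?_
      rintro p ⟨hp, hF, hx⟩
      exact hF (by simp)
    have hnz : ∀ f, w * f ∈ locI S F → f ∈ locI S F := by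
      intro f hf
      refine Ideal.mem_sInf.2 ?_
      rintro p ⟨hp, hF, x, hx, hpx⟩
      obtain ⟨q, hq, hqp⟩ := hFle p hp hF
      have hqF : (F : Set _) ⊆ (q : Set (MvPolynomial (Fin n) K)) := Ideal.span_le.1 hq.1.2
      have h1 : w * f ∈ q := Ideal.mem_sInf.1 hf ⟨hq.1.1, hqF, x, hx, hqp.trans hpx⟩
      rcases hq.1.1.mem_or_mem h1 with h2 | h2
      · exact absurd h2 (hw1 q ⟨hq, x, hx, hqp.trans hpx⟩)
      · exact hqp h2
    have hd : 1 ≤ g.totalDegree := by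
      by_contra hd
      have hw0 : w.totalDegree = 0 := by omega
      rw [totalDegree_eq_zero_iff_eq_C] at hw0
      obtain ⟨x, hx⟩ := hne
      have hwx : w ∈ ptIdeal x := by
        have h1 := (hmin x hx).1.2
        rw [← hspan] at h1
        exact h1 (Ideal.subset_span (Or.inl (by simp)))
      rw [hw0, RingHom.mem_ker, eval_C] at hwx
      rw [hwx, C_0] at hw0
      obtain ⟨q, hq, hqp⟩ := hFle (ptIdeal x) (ptIdeal_isMaximal x).isPrime
        (fun f hf => (hmin x hx).1.2 (Ideal.subset_span (Or.inl hf)))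
      exact hw1 q ⟨hq, x, hx, hqp⟩ (hw0 ▸ q.zero_mem)
    have har := arith (fun t => hf (locI S F) (t + s₀)) (fun t => hf (locI S (insert w F)) (t + s₀))
      (fun a b h => hf_mono _ (by omega)) g.totalDegree hd (fun t => hf_anti hJ _)
      (fun t => by
        have := hf_step hJ w hwJ g.totalDegree hwdeg hnz (t + s₀)
        simpa [add_right_comm] using this) t
    simp only [List.length_cons, List.map_cons, List.prod_cons]
    rw [← add_assoc, ← Nat.sum_range_add_choose, Finset.mul_sum]
    calc _ ≤ ∑ y ∈ Finset.range (t + 1), (l.map totalDegree).prod *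
          hf (locI S (insert w F)) (y + s₀) := Finset.sum_le_sum fun y _ => hIH y
      _ = (l.map totalDegree).prod * ∑ y ∈ Finset.range (t + 1),
          hf (locI S (insert w F)) (y + s₀) := by rw [Finset.mul_sum]
      _ ≤ (l.map totalDegree).prod * (g.totalDegree * hf (locI S F) (t + s₀)) :=
          Nat.mul_le_mul_left _ har
      _ = _ := by ring

theorem bezout [Infinite K] (S : Finset (Fin n → K))
    (l : List (MvPolynomial (Fin n) K)) (hl : l.length = n)
    (hmin : ∀ x ∈ S, ptIdeal x ∈ (Ideal.span {f | f ∈ l}).minimalPrimes) :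
    S.card ≤ (l.map totalDegree).prod := by
  classical
  rcases S.eq_empty_or_nonempty with rfl | hne
  · simp
  obtain ⟨s₀, hs⟩ := interp S
  let r : MvPolynomial (Fin n) K → MvPolynomial (Fin n) K → Prop :=
    fun a b => b.totalDegree ≤ a.totalDegree
  have : Std.Total r := ⟨fun a b => le_total _ _⟩
  have : IsTrans _ r := ⟨fun a b c h1 h2 => le_trans h2 h1⟩
  let l' := l.insertionSort r
  have hp : l'.Perm l := List.perm_insertionSort r l
  have hlen : l'.length = n := hp.length_eq.trans hl
  have key := bezout_aux S s₀ hs hne l' ∅ (by simp [hlen]) (List.pairwise_insertionSort r l) (by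
    intro x hx
    have := hmin x hx
    simpa [hp.mem_iff] using this)
  have hprod : (l'.map totalDegree).prod = (l.map totalDegree).prod := (hp.map _).prod_eq
  rw [hprod, hlen] at key
  exact asymp _ _ s₀ n fun t => (key t).trans (Nat.mul_le_mul_left _ (hf_le _ _))

end hilb

end BezoutAux
namespace BezoutAux

/-- chains of primes above B have length at most e -/
def dimLE {A : Type*} [CommRing A] (B : Ideal A) (e : ℕ) : Prop :=
  ∀ s : LTSeries (PrimeSpectrum A), B ≤ s.head.asIdeal → s.length ≤ e

lemma exists_cut {K A : Type*} [Field K] [Infinite K] [CommRing A] [IsNoetherianRing A]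
    [Algebra K A] (W : Submodule K A)
    (hW : ∀ p : Ideal A, p.IsPrime → (∀ w ∈ W, w ∈ p) → p.IsMaximal) (e : ℕ) :
    ∀ B : Ideal A, dimLE B e →
    ∃ l : List A, l.length = e ∧ (∀ f ∈ l, f ∈ W) ∧ dimLE (B ⊔ Ideal.span {f | f ∈ l}) 0 := by
  induction e with
  | zero => exact fun B hB => ⟨[], rfl, by simp, by simpa using hB⟩
  | succ e ih =>
    intro B hB
    let T1 : Set (Ideal A) := {p | p ∈ B.minimalPrimes ∧ ¬ W ≤ p.restrictScalars K}
    have hT1 : T1.Finite :=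
      (Ideal.finite_minimalPrimes_of_isNoetherianRing _ _).subset fun p hp => hp.1
    obtain ⟨w, hw, hwT⟩ := avoid W ((fun p => p.restrictScalars K) '' T1) (hT1.image _) (by
      rintro _ ⟨p, hp, rfl⟩
      exact hp.2)
    obtain ⟨l, hl, hlW, hd⟩ := ih (B ⊔ Ideal.span {w}) (by
      intro s hs
      obtain ⟨p, hp, hps⟩ := Ideal.exists_minimalPrimes_le (le_sup_left.trans hs)
      have hpp : p.IsPrime := hp.1.1
      have hws : w ∈ s.head.asIdeal := hs (Ideal.mem_sup_right (Ideal.subset_span rfl))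
      by_cases hWp : W ≤ p.restrictScalars K
      · have hmax := hW p hpp hWp
        by_contra hlen
        have h0 : p = s.head.asIdeal := hmax.eq_of_le s.head.isPrime.ne_top hps
        have h1 : s.head < s.last := by
          apply s.strictMono
          rw [Fin.lt_def]
          simp; omega
        have h2 : s.head.asIdeal < s.last.asIdeal := h1
        exact s.last.isPrime.ne_top ((h0 ▸ hmax).1.2 _ h2)
      · have hwp : w ∉ p := hwT _ ⟨p, ⟨hp, hWp⟩, rfl⟩
        have hlt : (⟨p, hpp⟩ : PrimeSpectrum A) < s.head :=
          lt_of_le_of_ne hps (fun h => hwp (by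
            have := congrArg PrimeSpectrum.asIdeal h
            change p = _ at this
            rw [this]; exact hws))
        have := hB (s.cons ⟨p, hpp⟩ hlt) (by simpa using hp.1.2)
        simpa using this)
    refine ⟨w :: l, by simp [hl], ?_, ?_⟩
    · intro f hf
      rcases List.mem_cons.1 hf with rfl | hf
      · exact hw
      · exact hlW f hf
    · have : B ⊔ Ideal.span {f | f ∈ w :: l} = B ⊔ Ideal.span {w} ⊔ Ideal.span {f | f ∈ l} := by
        rw [sup_assoc, ← Ideal.span_union]
        congr 2
        ext; simp
      rw [this]; exact hd

lemma minimal_of_dimLE {A : Type*} [CommRing A] {B M : Ideal A} (hB : dimLE B 0)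
    (hM : M.IsPrime) (h : B ≤ M) : M ∈ B.minimalPrimes := by
  refine ⟨⟨hM, h⟩, ?_⟩
  rintro q ⟨hq, hBq⟩ hqM
  by_contra hcon
  let s₀ : LTSeries (PrimeSpectrum A) := RelSeries.singleton _ (⟨M, hM⟩ : PrimeSpectrum A)
  have hlt : (⟨q, hq⟩ : PrimeSpectrum A) < s₀.head := lt_of_le_not_ge hqM hcon
  have := hB (s₀.cons ⟨q, hq⟩ hlt) (by simpa using hBq)
  simp at this

lemma dimLE_sup {A : Type*} [CommRing A] {I : Ideal A} (hI : I.IsPrime) {m : ℕ}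
    (hm : ringKrullDim (A ⧸ I) = m) {R : A} (hR : R ∉ I) (s : LTSeries (PrimeSpectrum A))
    (hs : I ⊔ Ideal.span {R} ≤ s.head.asIdeal) : s.length + 1 ≤ m := by
  have hlt : (⟨I, hI⟩ : PrimeSpectrum A) < s.head :=
    lt_of_le_of_ne (le_sup_left.trans hs) (fun h => hR (by
      have := congrArg PrimeSpectrum.asIdeal h
      change I = _ at this
      rw [this]; exact hs (Ideal.mem_sup_right (Ideal.subset_span rfl))))
  let s' := s.cons ⟨I, hI⟩ hlt
  have hmem : ∀ i, s' i ∈ PrimeSpectrum.zeroLocus (I : Set A) := by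
    intro i
    have h0 : s'.head ≤ s' i := LTSeries.head_le s' i
    have h1 : s'.head = ⟨I, hI⟩ := by simp [s']
    rw [h1] at h0
    exact h0
  rw [ringKrullDim_quotient] at hm
  let s'' : LTSeries (PrimeSpectrum.zeroLocus (I : Set A)) :=
    ⟨s'.length, fun i => ⟨s' i, hmem i⟩, fun i => s'.step i⟩
  have := Order.LTSeries.length_le_krullDim s''
  rw [hm] at this
  have h2 : s''.length = s.length + 1 := by simp [s'', s']
  rw [h2] at this
  exact_mod_cast this

lemma max_of_frob {k K : Type*} [Field k] [Fintype k] [Field K] [Algebra k K] {n : ℕ}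
    (p : Ideal (MvPolynomial (Fin n) K)) (hp : p.IsPrime)
    (h : ∀ i, (X i ^ Fintype.card k - X i : MvPolynomial (Fin n) K) ∈ p) : p.IsMaximal := by
  have h1 : ∀ i, ∃ a : k, (X i - C (algebraMap k K a) : MvPolynomial (Fin n) K) ∈ p := by
    intro i
    have hm : (Polynomial.X ^ Fintype.card k - Polynomial.X : Polynomial k).Monic := by
      refine Polynomial.monic_X_pow_sub ?_
      rw [Polynomial.degree_X]
      exact_mod_cast Fintype.one_lt_card
    have h0 := Polynomial.prod_multiset_X_sub_C_of_monic_of_roots_card_eq hm (by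
      rw [FiniteField.roots_X_pow_card_sub_X, FiniteField.X_pow_card_sub_X_natDegree_eq k
        Fintype.one_lt_card]
      rfl)
    rw [FiniteField.roots_X_pow_card_sub_X] at h0
    have h2 := congrArg (Polynomial.eval₂ (C.comp (algebraMap k K))
      (X i : MvPolynomial (Fin n) K)) h0
    have h3 := h i
    have h4 : (X i ^ Fintype.card k - X i : MvPolynomial (Fin n) K) =
        ∏ a : k, (X i - C (algebraMap k K a)) := by
      change Polynomial.eval₂ (C.comp (algebraMap k K)) (X i : MvPolynomial (Fin n) K)
        (∏ a : k, (Polynomial.X - Polynomial.C a)) = _ at h2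
      rw [Polynomial.eval₂_finsetProd] at h2
      simpa using h2.symm
    rw [h4, hp.prod_mem_iff] at h3
    obtain ⟨a, _, ha⟩ := h3
    exact ⟨a, ha⟩
  choose a ha using h1
  let x : Fin n → K := fun i => algebraMap k K (a i)
  have hle : ptIdeal x ≤ p := by
    have e : (Ideal.Quotient.mkₐ K p) =
        (Algebra.ofId K (MvPolynomial (Fin n) K ⧸ p)).comp (aeval x) := by
      apply MvPolynomial.algHom_ext
      intro i
      have := ha i
      rw [← Ideal.Quotient.eq_zero_iff_mem, map_sub, sub_eq_zero] at this
      simp only [AlgHom.comp_apply, aeval_X]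
      exact this
    intro f hf
    have h3 := congrArg (fun g => g f) e
    rw [RingHom.mem_ker] at hf
    have h4 : (aeval x) f = 0 := by simpa [aeval_eq_eval] using hf
    simp only [AlgHom.comp_apply, h4, map_zero] at h3
    exact Ideal.Quotient.eq_zero_iff_mem.1 h3
  rw [← (ptIdeal_isMaximal x).eq_of_le hp.ne_top hle]
  exact ptIdeal_isMaximal x

lemma descend {k K σ : Type*} [Field k] [Field K] [Algebra k K] {c : ℕ}
    (P : Fin c → MvPolynomial σ k) (R : MvPolynomial σ k)
    (h : map (algebraMap k K) R ∈ Ideal.span (Set.range fun i => map (algebraMap k K) (P i))) :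
    R ∈ Ideal.span (Set.range P) := by
  classical
  obtain ⟨φ, hφ⟩ := LinearMap.exists_leftInverse_of_injective (Algebra.linearMap k K)
    (LinearMap.ker_eq_bot.2 (algebraMap k K).injective)
  have hφ' : ∀ a : k, φ (algebraMap k K a) = a := fun a => congrArg (fun f => f a) hφ
  obtain ⟨b, hb⟩ := (Ideal.mem_span_range_iff_exists_fun).1 h
  let ψ : MvPolynomial σ K → MvPolynomial σ k := fun f =>
    ∑ m ∈ f.support, monomial m (φ (coeff m f))
  have hψ : ∀ f m, coeff m (ψ f) = φ (coeff m f) := by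
    intro f m
    simp only [ψ, coeff_sum, coeff_monomial]
    rw [Finset.sum_ite_eq' ]
    split_ifs with hm
    · rfl
    · rw [notMem_support_iff.1 hm, map_zero]
  have : R = ∑ i, ψ (b i) * P i := by
    ext m
    have := congrArg (fun f => φ (coeff m f)) hb
    simp only [coeff_sum, coeff_map, map_sum, hφ'] at this
    rw [← this, coeff_sum]
    refine Finset.sum_congr rfl fun i _ => ?_
    rw [coeff_mul, coeff_mul, map_sum]
    refine Finset.sum_congr rfl fun u _ => ?_
    rw [coeff_map, hψ, mul_comm, ← Algebra.smul_def, map_smul, smul_eq_mul, mul_comm]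
  rw [this]
  exact Ideal.sum_mem _ fun i _ => Ideal.mul_mem_left _ _ (Ideal.subset_span ⟨i, rfl⟩)

end BezoutAux

/-- Let k = 𝔽_q with q > a·D, D = ∏ dᵢ, and P₁,…,P_c polynomials of
degrees d₁,…,d_c on k^n whose zero scheme X over the algebraic closure K is an
irreducible complete intersection of dimension n − c (the ideal they generate in
K[x₁,…,x_n] is prime and the quotient has Krull dimension n − c), with
|X(𝔽_q)| > q^{n-c}(q−1)/q.  Then any polynomial R of degree a vanishing on all
𝔽_q-points of X belongs to the ideal (P₁,…,P_c). -/
theorem stmt19 {k : Type*} [Field k] [Fintype k] (n c a : ℕ) (hc : c ≤ n)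
    (d : Fin c → ℕ) (P : Fin c → MvPolynomial (Fin n) k)
    (hdeg : ∀ i, (P i).totalDegree = d i)
    (hq : a * ∏ i, d i < Fintype.card k)
    (hprime :
      (Ideal.span (Set.range fun i =>
        MvPolynomial.map (algebraMap k (AlgebraicClosure k)) (P i))).IsPrime)
    (hdim :
      ringKrullDim
        (MvPolynomial (Fin n) (AlgebraicClosure k) ⧸
          Ideal.span (Set.range fun i =>
            MvPolynomial.map (algebraMap k (AlgebraicClosure k)) (P i)))
        = (n - c : ℕ))
    (hcount :
      (Fintype.card k : ℝ) ^ (n - c : ℕ) * ((Fintype.card k : ℝ) - 1) /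
          (Fintype.card k : ℝ)
        < (Nat.card {x : Fin n → k // ∀ i, MvPolynomial.eval x (P i) = 0} : ℝ))
    (R : MvPolynomial (Fin n) k) (hR : R.totalDegree = a)
    (hvan : ∀ x : Fin n → k, (∀ i, MvPolynomial.eval x (P i) = 0) →
      MvPolynomial.eval x R = 0) :
    R ∈ Ideal.span (Set.range P) := by
  classical
  by_contra hcon
  have hR' : map (algebraMap k (AlgebraicClosure k)) R ∉
      (Ideal.span (Set.range fun i =>
        MvPolynomial.map (algebraMap k (AlgebraicClosure k)) (P i))) :=
    fun h => hcon (BezoutAux.descend P R h)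
  set K := AlgebraicClosure k with hK
  set q := Fintype.card k with hqdef
  have hq1 : 1 < q := Fintype.one_lt_card
  let I : Ideal (MvPolynomial (Fin n) K) := Ideal.span (Set.range fun i =>
        MvPolynomial.map (algebraMap k K) (P i))
  let ι : (Fin n → k) → (Fin n → K) := fun x i => algebraMap k K (x i)
  have hι : Function.Injective ι := fun x y h => by
    ext i
    exact (algebraMap k K).injective (congrFun h i)
  have hev : ∀ x f, eval (ι x) (map (algebraMap k K) f) = algebraMap k K (eval x f) := by
    intro x f
    induction f using MvPolynomial.induction_on with
    | C a => simp
    | add p q hp hq => simp [hp, hq]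
    | mul_X p i hp => simp [hp, ι]
  let S₀ : Finset (Fin n → k) := Finset.univ.filter fun x => ∀ i, eval x (P i) = 0
  let S : Finset (Fin n → K) := S₀.image ι
  have hScard : S.card = Nat.card {x : Fin n → k // ∀ i, MvPolynomial.eval x (P i) = 0} := by
    rw [Finset.card_image_of_injective _ hι, Nat.card_eq_fintype_card, Fintype.card_subtype]
  rw [← hScard] at hcount
  let R' := map (algebraMap k K) R
  have hSI : ∀ x ∈ S, I ⊔ Ideal.span {R'} ≤ BezoutAux.ptIdeal x := by
    intro x hx
    obtain ⟨y, hy, rfl⟩ := Finset.mem_image.1 hx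
    have hy' := (Finset.mem_filter.1 hy).2
    refine sup_le (Ideal.span_le.2 ?_) (Ideal.span_le.2 ?_)
    · rintro _ ⟨i, rfl⟩
      rw [SetLike.mem_coe, RingHom.mem_ker, hev, hy' i, map_zero]
    · rintro _ rfl
      rw [SetLike.mem_coe, RingHom.mem_ker, hev, hvan y hy', map_zero]
  have hSpos : 0 < S.card := by
    have : (0 : ℝ) ≤ (q : ℝ) ^ (n - c : ℕ) * ((q : ℝ) - 1) / (q : ℝ) := by
      have : (1 : ℝ) ≤ q := by exact_mod_cast hq1.le
      have : (0 : ℝ) ≤ (q : ℝ) - 1 := by linarith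
      positivity
    exact_mod_cast this.trans_lt hcount
  have hdimR := BezoutAux.dimLE_sup hprime hdim hR'
  obtain ⟨x₀, hx₀⟩ := Finset.card_pos.1 hSpos
  have hm1 : 1 ≤ n - c := by
    have := hdimR (RelSeries.singleton _
      ⟨BezoutAux.ptIdeal x₀, (BezoutAux.ptIdeal_isMaximal x₀).isPrime⟩) (hSI x₀ hx₀)
    omega
  obtain ⟨m, hm⟩ : ∃ m, n - c = m + 1 := ⟨n - c - 1, by omega⟩
  let W : Submodule K (MvPolynomial (Fin n) K) :=
    Submodule.span K (Set.range fun i : Fin n => (X i ^ q - X i : MvPolynomial (Fin n) K))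
  have hWpt : ∀ x ∈ S, ∀ w ∈ W, w ∈ BezoutAux.ptIdeal x := by
    intro x hx
    obtain ⟨y, hy, rfl⟩ := Finset.mem_image.1 hx
    have : W ≤ (BezoutAux.ptIdeal (ι y)).restrictScalars K := by
      refine Submodule.span_le.2 ?_
      rintro _ ⟨i, rfl⟩
      change _ ∈ BezoutAux.ptIdeal (ι y)
      rw [RingHom.mem_ker]
      simp only [map_sub, map_pow, eval_X, ι]
      rw [← map_pow, FiniteField.pow_card, sub_self]
    exact fun w hw => this hw
  have hWdeg : ∀ w ∈ W, w.totalDegree ≤ q := by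
    have : W ≤ restrictTotalDegree (Fin n) K q := by
      refine Submodule.span_le.2 ?_
      rintro _ ⟨i, rfl⟩
      rw [SetLike.mem_coe, mem_restrictTotalDegree]
      refine (totalDegree_sub _ _).trans (max_le ?_ ?_)
      · rw [totalDegree_X_pow]
      · rw [totalDegree_X]; exact hq1.le
    exact fun w hw => (mem_restrictTotalDegree _ _ _).1 (this hw)
  obtain ⟨l, hl, hlW, hld⟩ := BezoutAux.exists_cut W (fun p hp hpW =>
    BezoutAux.max_of_frob (k := k) p hp fun i => hpW _ (Submodule.subset_span ⟨i, rfl⟩)) m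
    (I ⊔ Ideal.span {R'}) (fun s hs => by have := hdimR s hs; omega)
  let l' := List.ofFn (fun i => map (algebraMap k K) (P i)) ++ R' :: l
  have hspan : Ideal.span {f | f ∈ l'} = I ⊔ Ideal.span {R'} ⊔ Ideal.span {f | f ∈ l} := by
    simp only [I, ← Ideal.span_union]
    refine congrArg Ideal.span ?_
    ext f
    simp [l', List.mem_ofFn, or_assoc, or_left_comm]
  have hbez := BezoutAux.bezout S l' (by simp [l', hl]; omega) (by
    intro x hx
    rw [hspan]
    refine BezoutAux.minimal_of_dimLE hld (BezoutAux.ptIdeal_isMaximal x).isPrime ?_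
    exact sup_le (hSI x hx) (Ideal.span_le.2 fun f hf => hWpt x hx f (hlW f hf)))
  have hprod : (l'.map totalDegree).prod ≤ (∏ i, d i) * (a * q ^ m) := by
    simp only [l', List.map_append, List.prod_append, List.map_cons, List.prod_cons, List.map_ofFn,
      List.prod_ofFn]
    refine Nat.mul_le_mul (Finset.prod_le_prod' fun i _ => ?_) (Nat.mul_le_mul ?_ ?_)
    · rw [← hdeg i]
      exact Finset.sup_mono (support_map_subset _ _)
    · rw [← hR]
      exact Finset.sup_mono (support_map_subset _ _)
    · rw [← hl, ← List.length_map (as := l) totalDegree]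
      refine List.prod_le_pow_card _ _ ?_
      intro e he
      obtain ⟨f, hf, rfl⟩ := List.mem_map.1 he
      exact hWdeg f (hlW f hf)
  have hfin : S.card ≤ (q - 1) * q ^ m := by
    refine (hbez.trans hprod).trans ?_
    rw [← mul_assoc, mul_comm _ a]
    exact Nat.mul_le_mul_right _ (by omega)
  have hfin' : (S.card : ℝ) ≤ ((q : ℝ) - 1) * (q : ℝ) ^ m := by
    have := (Nat.cast_le (α := ℝ)).2 hfin
    rwa [Nat.cast_mul, Nat.cast_sub hq1.le, Nat.cast_pow, Nat.cast_one] at this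
  have hq0 : (q : ℝ) ≠ 0 := by positivity
  rw [hm] at hcount
  have : (q : ℝ) ^ (m + 1) * ((q : ℝ) - 1) / (q : ℝ) = ((q : ℝ) - 1) * (q : ℝ) ^ m := by
    field_simp
    ring
  linarith
end
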